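/- arXiv:2304.04308 — 5 statements merged into one kernel-verified Lean document; each statement's English description precedes it below -/
import Mathlib

section
/- Let g be a seminorm on ℝ^T that is not identically zero, let h be a norm on ℝ^n, and let λ ≥ 0. Define the induced-norm uncertainty set U_{(h,g)} = {Δ ∈ ℝ^{T×n} : g(Δx) ≤ λ·h(x) for all x ∈ ℝ^n}. Then for every z ∈ ℝ^T and every β ∈ ℝ^n, the supremum of g(z + Δβ) over Δ ∈ U_{(h,g)} is attained and equals g(z) + λ·h(β). -/
/-- Supporting functional of a seminorm at a point, by Hahn–Banach. -/
theorem Seminorm.exists_dual_eq_and_le {E : Type*} [AddCommGroup E] [Module ℝ E]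
    (p : Seminorm ℝ E) (x : E) : ∃ f : E →ₗ[ℝ] ℝ, f x = p x ∧ ∀ y, |f y| ≤ p y := by
  rcases eq_or_ne x 0 with rfl | hx
  · exact ⟨0, by simp, fun y => by simp⟩
  obtain ⟨f, hf, hle⟩ := exists_extension_of_le_sublinear
    (LinearPMap.mkSpanSingleton (K := ℝ) x (p x) hx) p
    (fun c hc y => by rw [map_smul_eq_mul, Real.norm_of_nonneg hc.le])
    (fun y z => map_add_le_add p y z) (by
      rintro ⟨_, hy⟩
      obtain ⟨c, rfl⟩ := Submodule.mem_span_singleton.1 hy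
      rw [LinearPMap.mkSpanSingleton'_apply, RingHom.id_apply, map_smul_eq_mul, smul_eq_mul]
      exact mul_le_mul_of_nonneg_right (le_abs_self c) (apply_nonneg p x))
  refine ⟨f, ?_, fun y => abs_le'.2 ⟨hle y, ?_⟩⟩
  · rw [hf ⟨x, Submodule.mem_span_singleton_self x⟩]
    exact LinearPMap.mkSpanSingleton_apply ℝ ℝ hx (p x)
  · simpa using hle (-y)

/-- A nonzero seminorm has, at each point, a unit direction of maximal growth. -/
theorem Seminorm.exists_eq_one_and_add_smul {E : Type*} [AddCommGroup E] [Module ℝ E]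
    (p : Seminorm ℝ E) (hp : ∃ u, p u ≠ 0) (z : E) :
    ∃ v, p v = 1 ∧ ∀ c : ℝ, 0 ≤ c → p (z + c • v) = p z + c := by
  have hunit : ∀ u, p u ≠ 0 → p ((p u)⁻¹ • u) = 1 := fun u hu => by
    rw [map_smul_eq_mul, Real.norm_of_nonneg (inv_nonneg.2 (apply_nonneg p u)),
      inv_mul_cancel₀ hu]
  by_cases hz : p z = 0
  · obtain ⟨u, hu⟩ := hp
    refine ⟨(p u)⁻¹ • u, hunit u hu, fun c hc => ?_⟩
    have hcv : p (c • (p u)⁻¹ • u) = c := by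
      rw [map_smul_eq_mul, hunit u hu, mul_one, Real.norm_of_nonneg hc]
    apply le_antisymm
    · simpa only [hcv] using map_add_le_add p z (c • (p u)⁻¹ • u)
    · have := map_sub_le_add p (z + c • (p u)⁻¹ • u) z
      rw [add_sub_cancel_left, hcv] at this
      linarith
  · refine ⟨(p z)⁻¹ • z, hunit z hz, fun c hc => ?_⟩
    have hzc : z + c • (p z)⁻¹ • z = (1 + c * (p z)⁻¹) • z := by
      rw [add_smul, one_smul, mul_smul]
    have hnonneg : 0 ≤ 1 + c * (p z)⁻¹ := by
      have := apply_nonneg p z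
      positivity
    rw [hzc, map_smul_eq_mul, Real.norm_of_nonneg hnonneg]
    field_simp


/-- For a seminorm `g` on `ℝ^T` that is not identically zero, a norm `h` on
`ℝ^n`, and `λ ≥ 0`, the supremum of `g (z + Δ β)` over the induced-norm uncertainty set
`U_{(h,g)} = {Δ | g (Δ x) ≤ λ * h x for all x}` is attained and equals `g z + λ * h β`. -/
theorem statement0 {T n : ℕ} (g : Seminorm ℝ (Fin T → ℝ)) (hg : ∃ u, g u ≠ 0)
    (h : Seminorm ℝ (Fin n → ℝ)) (hh : ∀ x, h x = 0 → x = 0)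
    (lam : ℝ) (hlam : 0 ≤ lam) (z : Fin T → ℝ) (β : Fin n → ℝ) :
    IsGreatest
      ((fun Δ : Matrix (Fin T) (Fin n) ℝ => g (z + Δ.mulVec β)) ''
        {Δ : Matrix (Fin T) (Fin n) ℝ | ∀ x : Fin n → ℝ, g (Δ.mulVec x) ≤ lam * h x})
      (g z + lam * h β) := by

  constructor
  · obtain ⟨f, hfβ, hf⟩ := h.exists_dual_eq_and_le β
    obtain ⟨v, hv, hgrow⟩ := g.exists_eq_one_and_add_smul hg z
    have hΔ : ∀ x, (LinearMap.toMatrix' (lam • f.smulRight v)).mulVec x = (lam * f x) • v := by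
      intro x
      rw [LinearMap.toMatrix'_mulVec, LinearMap.smul_apply, LinearMap.smulRight_apply, mul_smul]
    refine ⟨LinearMap.toMatrix' (lam • f.smulRight v), fun x => ?_, ?_⟩
    · rw [hΔ, map_smul_eq_mul, hv, mul_one, Real.norm_eq_abs, abs_mul, abs_of_nonneg hlam]
      exact mul_le_mul_of_nonneg_left (hf x) hlam
    · simp only [hΔ, hfβ]
      exact hgrow _ (mul_nonneg hlam (apply_nonneg h β))
  · rintro _ ⟨Δ, hΔ, rfl⟩
    exact (map_add_le_add g z _).trans (add_le_add_right (hΔ β) _)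
end

section
/- Let g be a seminorm on ℝ^T, h a norm on ℝ^n with dual norm h*, λ ≥ 0, z ∈ ℝ^T with g(z) ≠ 0, and β ∈ ℝ^n. Let v ∈ ℝ^n satisfy h*(v) = 1 and ⟨v, β⟩ = h(β), and define Δ̂ = (λ/g(z))·z·vᵀ. Then g(z + Δ̂β) = g(z) + λ·h(β), and g(Δ̂x) ≤ λ·h(x) for every x ∈ ℝ^n (so Δ̂ ∈ U_{(h,g)}). -/
/-- The dual norm of `h` with respect to the Euclidean inner product:
`h*(v) = sup {⟨v, x⟩ : h x ≤ 1}`. -/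
noncomputable def dualNorm {n : ℕ} (h : Seminorm ℝ (Fin n → ℝ)) (v : Fin n → ℝ) : ℝ :=
  sSup {r : ℝ | ∃ x : Fin n → ℝ, h x ≤ 1 ∧ r = ∑ i, v i * x i}

/-- A real set with nonzero supremum is bounded above, so `dualNorm h v = 1` forces the
pairing with `v` to be dominated by `h`. -/
theorem sum_mul_le_of_dualNorm_eq_one {n : ℕ} {h : Seminorm ℝ (Fin n → ℝ)}
    (hh : ∀ x, h x = 0 → x = 0) {v : Fin n → ℝ} (hv : dualNorm h v = 1) (x : Fin n → ℝ) :
    ∑ i, v i * x i ≤ h x := by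
  have hbdd : BddAbove {r : ℝ | ∃ x : Fin n → ℝ, h x ≤ 1 ∧ r = ∑ i, v i * x i} := by
    by_contra hb
    have h0 : dualNorm h v = 0 := Real.sSup_of_not_bddAbove hb
    linarith
  rcases (apply_nonneg h x).eq_or_lt with hx | hx
  · simp [hh x hx.symm]
  · have hle : (h x)⁻¹ * ∑ i, v i * x i ≤ 1 := by
      rw [← hv]
      refine le_csSup hbdd ⟨(h x)⁻¹ • x, ?_, ?_⟩
      · rw [map_smul_eq_mul, Real.norm_of_nonneg (inv_nonneg.2 hx.le), inv_mul_cancel₀ hx.ne']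
      · simp only [Finset.mul_sum, Pi.smul_apply, smul_eq_mul]
        exact Finset.sum_congr rfl fun i _ => by ring
    rwa [inv_mul_le_iff₀ hx, mul_one] at hle

theorem abs_sum_mul_le_of_dualNorm_eq_one {n : ℕ} {h : Seminorm ℝ (Fin n → ℝ)}
    (hh : ∀ x, h x = 0 → x = 0) {v : Fin n → ℝ} (hv : dualNorm h v = 1) (x : Fin n → ℝ) :
    |∑ i, v i * x i| ≤ h x := by
  refine abs_le'.2 ⟨sum_mul_le_of_dualNorm_eq_one hh hv x, ?_⟩
  simpa using sum_mul_le_of_dualNorm_eq_one hh hv (-x)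

theorem smul_vecMulVec_mulVec {T n : ℕ} (c : ℝ) (z : Fin T → ℝ) (v x : Fin n → ℝ) :
    (c • Matrix.vecMulVec z v).mulVec x = (c * ∑ i, v i * x i) • z := by
  ext j
  simp only [Matrix.mulVec, dotProduct, Matrix.smul_apply, Matrix.vecMulVec_apply, smul_eq_mul,
    Pi.smul_apply, Finset.mul_sum, Finset.sum_mul]
  exact Finset.sum_congr rfl fun i _ => by ring

/-- For a seminorm `g`, a norm `h`, `λ ≥ 0`, `z` with `g z ≠ 0`, `β`, and
`v` with `h*(v) = 1` and `⟨v, β⟩ = h β`, the matrix `Δ̂ = (λ / g z) · z vᵀ` satisfies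
`g (z + Δ̂ β) = g z + λ * h β` and `g (Δ̂ x) ≤ λ * h x` for every `x`
(so `Δ̂ ∈ U_{(h,g)}`). -/
theorem statement4 {T n : ℕ} (g : Seminorm ℝ (Fin T → ℝ))
    (h : Seminorm ℝ (Fin n → ℝ)) (hh : ∀ x, h x = 0 → x = 0)
    (lam : ℝ) (hlam : 0 ≤ lam)
    (z : Fin T → ℝ) (hz : g z ≠ 0) (β : Fin n → ℝ)
    (v : Fin n → ℝ) (hv1 : dualNorm h v = 1) (hv2 : ∑ i, v i * β i = h β) :
    g (z + ((lam / g z) • Matrix.vecMulVec z v).mulVec β) = g z + lam * h β ∧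
    ∀ x : Fin n → ℝ, g (((lam / g z) • Matrix.vecMulVec z v).mulVec x) ≤ lam * h x := by
  have hgz : 0 < g z := lt_of_le_of_ne (apply_nonneg g z) hz.symm
  have hc : 0 ≤ lam / g z := div_nonneg hlam hgz.le
  refine ⟨?_, fun x => ?_⟩
  · have hβ : 0 ≤ lam / g z * h β := mul_nonneg hc (apply_nonneg h β)
    have hz' : z + (lam / g z * h β) • z = (1 + lam / g z * h β) • z := by
      rw [add_smul, one_smul]
    rw [smul_vecMulVec_mulVec, hv2, hz', map_smul_eq_mul, Real.norm_of_nonneg (by positivity)]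
    field_simp
  · rw [smul_vecMulVec_mulVec, map_smul_eq_mul, Real.norm_eq_abs, abs_mul, abs_of_nonneg hc]
    calc lam / g z * |∑ i, v i * x i| * g z = lam * |∑ i, v i * x i| := by field_simp
      _ ≤ lam * h x :=
        mul_le_mul_of_nonneg_left (abs_sum_mul_le_of_dualNorm_eq_one hh hv1 x) hlam
end

section
/- Let g be a seminorm on ℝ^T that is not identically zero, h a norm on ℝ^n with dual norm h*, λ ≥ 0, z ∈ ℝ^T with g(z) = 0, and β ∈ ℝ^n. Let u ∈ ℝ^T satisfy g(u) = 1, let v ∈ ℝ^n satisfy h*(v) = 1 and ⟨v, β⟩ = h(β), and define Δ̂ = λ·u·vᵀ. Then g(z + Δ̂β) = λ·h(β) = g(z) + λ·h(β), and g(Δ̂x) ≤ λ·h(x) for every x ∈ ℝ^n (so Δ̂ ∈ U_{(h,g)}). -/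
/-- Hölder's inequality for the dual norm, whenever the supremum defining it is finite. -/
theorem abs_sum_mul_le_dualNorm_mul {n : ℕ} (h : Seminorm ℝ (Fin n → ℝ))
    (hh : ∀ x, h x = 0 → x = 0) (v : Fin n → ℝ)
    (hb : BddAbove {r : ℝ | ∃ x : Fin n → ℝ, h x ≤ 1 ∧ r = ∑ i, v i * x i}) (x : Fin n → ℝ) :
    |∑ i, v i * x i| ≤ dualNorm h v * h x := by
  have key (y : Fin n → ℝ) : ∑ i, v i * y i ≤ dualNorm h v * h y := by
    rcases (apply_nonneg h y).eq_or_lt with h0 | hpos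
    · simp [hh y h0.symm]
    · have hle : (h y)⁻¹ * ∑ i, v i * y i ≤ dualNorm h v := by
        refine le_csSup hb ⟨(h y)⁻¹ • y, ?_, ?_⟩
        · rw [map_smul_eq_mul, norm_inv, Real.norm_of_nonneg hpos.le, inv_mul_cancel₀ hpos.ne']
        · simp only [Finset.mul_sum, Pi.smul_apply, smul_eq_mul, mul_left_comm]
      rwa [inv_mul_le_iff₀ hpos, mul_comm] at hle
  refine abs_le'.2 ⟨key x, ?_⟩
  simpa [map_neg_eq_map] using key (-x)

/-- The value of a seminorm on the image of a vector under a multiple of a rank-one matrix. -/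
theorem seminorm_smul_vecMulVec_mulVec {T n : ℕ} (g : Seminorm ℝ (Fin T → ℝ)) (c : ℝ)
    (u : Fin T → ℝ) (v x : Fin n → ℝ) :
    g ((c • Matrix.vecMulVec u v).mulVec x) = |c| * |∑ i, v i * x i| * g u := by
  have hmul : (c • Matrix.vecMulVec u v).mulVec x = (c * ∑ i, v i * x i) • u := by
    ext j
    simp only [Matrix.mulVec, dotProduct, Matrix.smul_apply, Matrix.vecMulVec_apply, smul_eq_mul,
      Pi.smul_apply, Finset.mul_sum, Finset.sum_mul]
    exact Finset.sum_congr rfl fun i _ => by ring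
  rw [hmul, map_smul_eq_mul, Real.norm_eq_abs, abs_mul]

/-- Adding a vector in the kernel of a seminorm does not change its value. -/
theorem seminorm_add_eq_of_eq_zero {E : Type*} [AddCommGroup E] [Module ℝ E] (g : Seminorm ℝ E)
    {z : E} (hz : g z = 0) (w : E) : g (z + w) = g w := by
  refine le_antisymm (by simpa [hz] using map_add_le_add g z w) ?_
  simpa [hz] using map_sub_le_add g (z + w) z

/-- For a seminorm `g` not identically zero, a norm `h`, `λ ≥ 0`, `z` with
`g z = 0`, `β`, `u` with `g u = 1`, and `v` with `h*(v) = 1` and `⟨v, β⟩ = h β`, the matrix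
`Δ̂ = λ · u vᵀ` satisfies `g (z + Δ̂ β) = λ * h β = g z + λ * h β` and
`g (Δ̂ x) ≤ λ * h x` for every `x` (so `Δ̂ ∈ U_{(h,g)}`). -/
theorem statement5 {T n : ℕ} (g : Seminorm ℝ (Fin T → ℝ)) (hg : ∃ w, g w ≠ 0)
    (h : Seminorm ℝ (Fin n → ℝ)) (hh : ∀ x, h x = 0 → x = 0)
    (lam : ℝ) (hlam : 0 ≤ lam)
    (z : Fin T → ℝ) (hz : g z = 0) (β : Fin n → ℝ)
    (u : Fin T → ℝ) (hu : g u = 1)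
    (v : Fin n → ℝ) (hv1 : dualNorm h v = 1) (hv2 : ∑ i, v i * β i = h β) :
    g (z + (lam • Matrix.vecMulVec u v).mulVec β) = lam * h β ∧
    lam * h β = g z + lam * h β ∧
    ∀ x : Fin n → ℝ, g ((lam • Matrix.vecMulVec u v).mulVec x) ≤ lam * h x := by
  have hb : BddAbove {r : ℝ | ∃ x : Fin n → ℝ, h x ≤ 1 ∧ r = ∑ i, v i * x i} := by
    by_contra hnb
    rw [dualNorm, Real.sSup_of_not_bddAbove hnb] at hv1
    exact zero_ne_one hv1
  refine ⟨?_, by rw [hz, zero_add], fun x => ?_⟩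
  · rw [seminorm_add_eq_of_eq_zero g hz, seminorm_smul_vecMulVec_mulVec, hu, hv2,
      abs_of_nonneg hlam, abs_of_nonneg (apply_nonneg h β), mul_one]
  · rw [seminorm_smul_vecMulVec_mulVec, hu, abs_of_nonneg hlam, mul_one]
    have hx := abs_sum_mul_le_dualNorm_mul h hh v hb x
    rw [hv1, one_mul] at hx
    exact mul_le_mul_of_nonneg_left hx hlam
end

section
/- (Theorem 1) Let p, q ∈ [1, ∞], λ ≥ 0, y ∈ ℝ^T, and X̃ ∈ ℝ^{T×T·m} the block-diagonal forecast matrix built from forecasts X_1,…,X_T ∈ ℝ^m. Let U_{(q,p)} = {Δ ∈ ℝ^{T×T·m} : ‖Δβ‖_p ≤ λ·‖β‖_q for all β}. Then the adaptive robust regression problem and the regularized regression problem over the adaptive set Ω_adapt have equal optimal values: inf_{β ∈ Ω_adapt} sup_{Δ ∈ U_{(q,p)}} ‖y − (X̃ + Δ)β‖_p = inf_{β ∈ Ω_adapt} ( ‖y − X̃β‖_p + λ·‖β‖_q ). -/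
open scoped ENNReal

/-- The `ℓ_p` norm of a finite real vector, for `p ∈ [1, ∞]`
(`(∑ i, |x i| ^ p)^(1/p)` for finite `p`, `max_i |x i|` for `p = ∞`). -/
noncomputable def lpNorm (p : ℝ≥0∞) {ι : Type} [Fintype ι] (x : ι → ℝ) : ℝ :=
  if p = ∞ then ⨆ i, |x i| else (∑ i, |x i| ^ p.toReal) ^ (1 / p.toReal)

/-- The vector of past forecast errors
`Z_t = [X_{t-τ} - y_{t-τ} e | … | X_{t-1} - y_{t-1} e] ∈ ℝ^{m·τ}`
(time is indexed by `ℤ` so that the values for times `s ≤ 0` are the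
"additional fixed values" handling the edge cases). -/
def Zvec (m τ : ℕ) (X : ℤ → Fin m → ℝ) (y : ℤ → ℝ) (t : ℤ) : Fin τ × Fin m → ℝ :=
  fun s => X (t - τ + s.1) s.2 - y (t - τ + s.1)

/-- The adaptive set `Ω_adapt ⊆ ℝ^{T·m}`: all concatenated vectors `β = [β_1|…|β_T]`
with `β_t = β₀ + V₀ · Z_t` for all `t = 1, …, T`, for some `β₀ ∈ ℝ^m` and
`V₀ ∈ ℝ^{m × m·τ}` (row `t : Fin T` of the data corresponds to time `t + 1 ∈ ℤ`). -/
def OmegaAdapt (T m τ : ℕ) (X : ℤ → Fin m → ℝ) (y : ℤ → ℝ) :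
    Set (Fin T × Fin m → ℝ) :=
  {β | ∃ (β₀ : Fin m → ℝ) (V₀ : Matrix (Fin m) (Fin τ × Fin m) ℝ),
    ∀ (t : Fin T) (j : Fin m),
      β (t, j) = β₀ j + V₀.mulVec (Zvec m τ X y ((t : ℤ) + 1)) j}

/-- The block-diagonal forecast matrix `X̃ ∈ ℝ^{T × T·m}` whose `t`-th diagonal block is
`X_tᵀ`, so that `(X̃ β)_t = X_tᵀ β_t`. -/
def blockDiag (T m : ℕ) (X : ℤ → Fin m → ℝ) : Matrix (Fin T) (Fin T × Fin m) ℝ :=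
  fun t c => if c.1 = t then X ((t : ℤ) + 1) c.2 else 0

/-- The target vector `y ∈ ℝ^T`. -/
def targetVec (T : ℕ) (y : ℤ → ℝ) : Fin T → ℝ := fun t => y ((t : ℤ) + 1)

theorem lpNorm_eq_norm_toLp {p : ℝ≥0∞} (hp : 1 ≤ p) {ι : Type} [Fintype ι] (x : ι → ℝ) :
    lpNorm p x = (haveI : Fact (1 ≤ p) := ⟨hp⟩; ‖WithLp.toLp p x‖) := by
  have : Fact (1 ≤ p) := ⟨hp⟩
  unfold lpNorm
  split_ifs with h
  · subst h
    simp [PiLp.norm_eq_ciSup]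
  · rw [PiLp.norm_eq_sum (ENNReal.toReal_pos (by positivity) h)]
    simp

theorem lpNorm_of_isEmpty {p : ℝ≥0∞} (hp : 1 ≤ p) {ι : Type} [Fintype ι] [IsEmpty ι]
    (x : ι → ℝ) : lpNorm p x = 0 := by
  have : Fact (1 ≤ p) := ⟨hp⟩
  rw [lpNorm_eq_norm_toLp hp, Subsingleton.elim x 0, WithLp.toLp_zero, norm_zero]

theorem lpNorm_nonneg {p : ℝ≥0∞} (hp : 1 ≤ p) {ι : Type} [Fintype ι] (x : ι → ℝ) :
    0 ≤ lpNorm p x := by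
  have : Fact (1 ≤ p) := ⟨hp⟩
  rw [lpNorm_eq_norm_toLp hp]
  exact norm_nonneg (WithLp.toLp p x)

theorem lpNorm_smul {p : ℝ≥0∞} (hp : 1 ≤ p) {ι : Type} [Fintype ι] (c : ℝ) (x : ι → ℝ) :
    lpNorm p (c • x) = |c| * lpNorm p x := by
  have : Fact (1 ≤ p) := ⟨hp⟩
  rw [lpNorm_eq_norm_toLp hp, lpNorm_eq_norm_toLp hp, WithLp.toLp_smul, norm_smul,
    Real.norm_eq_abs]

theorem lpNorm_sub_le {p : ℝ≥0∞} (hp : 1 ≤ p) {ι : Type} [Fintype ι] (x z : ι → ℝ) :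
    lpNorm p (x - z) ≤ lpNorm p x + lpNorm p z := by
  have : Fact (1 ≤ p) := ⟨hp⟩
  simp only [lpNorm_eq_norm_toLp hp, WithLp.toLp_sub]
  exact norm_sub_le _ _

theorem exists_unit_direction {p : ℝ≥0∞} (hp : 1 ≤ p) {ι : Type} [Fintype ι] [Nonempty ι]
    (r : ι → ℝ) : ∃ u : ι → ℝ, lpNorm p u = 1 ∧ r = lpNorm p r • u := by
  have : Fact (1 ≤ p) := ⟨hp⟩
  rcases eq_or_ne (WithLp.toLp p r) 0 with h | h
  · obtain ⟨v, hv⟩ := exists_norm_eq (PiLp p fun _ : ι => ℝ) zero_le_one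
    have hr : r = 0 := by simpa using h
    refine ⟨WithLp.ofLp v, by simpa [lpNorm_eq_norm_toLp hp] using hv, ?_⟩
    rw [lpNorm_eq_norm_toLp hp, h, norm_zero, zero_smul, hr]
  · have hpos : lpNorm p r ≠ 0 := by
      rw [lpNorm_eq_norm_toLp hp]
      exact norm_ne_zero_iff.2 h
    refine ⟨(lpNorm p r)⁻¹ • r, ?_, by rw [smul_smul, mul_inv_cancel₀ hpos, one_smul]⟩
    rw [lpNorm_smul hp, abs_inv, abs_of_nonneg (lpNorm_nonneg hp r), inv_mul_cancel₀ hpos]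

theorem exists_norming_vector {q : ℝ≥0∞} (hq : 1 ≤ q) {κ : Type} [Fintype κ] (b : κ → ℝ) :
    ∃ a : κ → ℝ, a ⬝ᵥ b = lpNorm q b ∧ ∀ x : κ → ℝ, |a ⬝ᵥ x| ≤ lpNorm q x := by
  classical
  have : Fact (1 ≤ q) := ⟨hq⟩
  obtain ⟨g, hg, hgb⟩ := exists_dual_vector'' ℝ (WithLp.toLp q b)
  have key : ∀ x : κ → ℝ,
      (fun c => g (WithLp.toLp q (Pi.single c 1))) ⬝ᵥ x = g (WithLp.toLp q x) := by
    intro x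
    let f : (κ → ℝ) →ₗ[ℝ] ℝ := g.toLinearMap ∘ₗ (WithLp.linearEquiv q ℝ (κ → ℝ)).symm.toLinearMap
    have h := f.pi_apply_eq_sum_univ x
    have hs : ∀ c : κ, (fun j => if c = j then (1 : ℝ) else 0) = Pi.single c 1 := by
      intro c
      ext j
      simp [Pi.single_apply, eq_comm]
    simp only [hs, smul_eq_mul] at h
    rw [dotProduct]
    simp only [mul_comm _ (x _)]
    exact h.symm
  refine ⟨_, (key b).trans ?_, fun x => ?_⟩
  · rw [lpNorm_eq_norm_toLp hq]
    exact hgb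
  · rw [key, lpNorm_eq_norm_toLp hq, ← Real.norm_eq_abs]
    simpa using g.le_of_opNorm_le hg (WithLp.toLp q x)

/-- Worst-case robust loss over an induced-norm ball equals the norm-regularized loss. -/
theorem isGreatest_robust_loss {p q : ℝ≥0∞} (hp : 1 ≤ p) (hq : 1 ≤ q) {ι κ : Type} [Fintype ι]
    [Fintype κ] [Nonempty ι] {lam : ℝ} (hlam : 0 ≤ lam) (A : Matrix ι κ ℝ) (y : ι → ℝ)
    (b : κ → ℝ) :
    IsGreatest ((fun Δ : Matrix ι κ ℝ => lpNorm p (y - (A + Δ).mulVec b)) ''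
        {Δ : Matrix ι κ ℝ | ∀ x : κ → ℝ, lpNorm p (Δ.mulVec x) ≤ lam * lpNorm q x})
      (lpNorm p (y - A.mulVec b) + lam * lpNorm q b) := by
  have split : ∀ Δ : Matrix ι κ ℝ,
      y - (A + Δ).mulVec b = (y - A.mulVec b) - Δ.mulVec b := by
    intro Δ
    rw [Matrix.add_mulVec, sub_sub]
  constructor
  · obtain ⟨u, hu, hr⟩ := exists_unit_direction hp (y - A.mulVec b)
    obtain ⟨a, hab, ha⟩ := exists_norming_vector hq b
    have hmul : ∀ x, (Matrix.vecMulVec (-lam • u) a).mulVec x = (-(lam * (a ⬝ᵥ x))) • u := by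
      intro x
      rw [Matrix.vecMulVec_mulVec]
      ext i
      simp
      ring
    refine ⟨Matrix.vecMulVec (-lam • u) a, fun x => ?_, ?_⟩
    · rw [hmul, lpNorm_smul hp, hu, mul_one, abs_neg, abs_mul, abs_of_nonneg hlam]
      exact mul_le_mul_of_nonneg_left (ha x) hlam
    · have hsum : y - (A + Matrix.vecMulVec (-lam • u) a).mulVec b
          = (lpNorm p (y - A.mulVec b) + lam * lpNorm q b) • u := by
        rw [split, hmul, hab, neg_smul, sub_neg_eq_add, add_smul, ← hr]
      have hnn := add_nonneg (lpNorm_nonneg hp (y - A.mulVec b))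
        (mul_nonneg hlam (lpNorm_nonneg hq b))
      simp only [hsum]
      rw [lpNorm_smul hp, hu, mul_one, abs_of_nonneg hnn]
  · rintro _ ⟨Δ, hΔ, rfl⟩
    simp only [split]
    exact (lpNorm_sub_le hp _ _).trans (add_le_add_right (hΔ b) _)

theorem statement6 {T m τ : ℕ} (hτ : 1 ≤ τ) (p q : ℝ≥0∞) (hp : 1 ≤ p) (hq : 1 ≤ q)
    (lam : ℝ) (hlam : 0 ≤ lam) (X : ℤ → Fin m → ℝ) (y : ℤ → ℝ) :
    sInf ((fun β : Fin T × Fin m → ℝ =>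
        sSup ((fun Δ : Matrix (Fin T) (Fin T × Fin m) ℝ =>
            lpNorm p (targetVec T y - (blockDiag T m X + Δ).mulVec β)) ''
          {Δ : Matrix (Fin T) (Fin T × Fin m) ℝ |
            ∀ β' : Fin T × Fin m → ℝ, lpNorm p (Δ.mulVec β') ≤ lam * lpNorm q β'})) ''
      OmegaAdapt T m τ X y)
    = sInf ((fun β : Fin T × Fin m → ℝ =>
        lpNorm p (targetVec T y - (blockDiag T m X).mulVec β) + lam * lpNorm q β) ''
      OmegaAdapt T m τ X y) := by
  congr 1
  refine Set.image_congr' fun β => ?_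
  cases T with
  | zero =>
    have hzero : ∀ x : Fin 0 → ℝ, lpNorm p x = 0 := lpNorm_of_isEmpty hp
    have hβ : ∀ x : Fin 0 × Fin m → ℝ, lpNorm q x = 0 := lpNorm_of_isEmpty hq
    simp only [hzero, hβ, mul_zero, le_refl, implies_true, Set.ofPred_true, add_zero]
    rw [Set.image_univ, Set.range_const, csSup_singleton]
  | succ n => exact (isGreatest_robust_loss hp hq hlam _ _ β).csSup_eq
end

section
/- (Adaptive Lasso) Let λ ≥ 0, y ∈ ℝ^T, X̃ ∈ ℝ^{T×T·m} the block-diagonal forecast matrix, and U_{(1,2)} = {Δ ∈ ℝ^{T×T·m} : ‖Δβ‖_2 ≤ λ·‖β‖_1 for all β}. Then inf_{β ∈ Ω_adapt} sup_{Δ ∈ U_{(1,2)}} ‖y − (X̃ + Δ)β‖_2 = inf_{β ∈ Ω_adapt} ( ‖y − X̃β‖_2 + λ·‖β‖_1 ). -/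
open scoped ENNReal

theorem lpNorm_two_eq_norm {ι : Type} [Fintype ι] (x : ι → ℝ) :
    lpNorm 2 x = ‖WithLp.toLp 2 x‖ := by
  simp [lpNorm, EuclideanSpace.norm_eq, Real.sqrt_eq_rpow]

theorem lpNorm_one_eq_sum {ι : Type} [Fintype ι] (x : ι → ℝ) :
    lpNorm 1 x = ∑ i, |x i| := by
  simp [lpNorm]

/-- Every vector of a nontrivial real normed space is a nonnegative multiple of a unit vector. -/
theorem exists_norm_eq_one_norm_smul_eq {E : Type*} [NormedAddCommGroup E] [NormedSpace ℝ E]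
    [Nontrivial E] (x : E) : ∃ u : E, ‖u‖ = 1 ∧ ‖x‖ • u = x := by
  rcases eq_or_ne x 0 with rfl | hx
  · obtain ⟨u, hu⟩ := exists_norm_eq E zero_le_one
    exact ⟨u, hu, by simp⟩
  · refine ⟨‖x‖⁻¹ • x, norm_smul_inv_norm hx, ?_⟩
    rw [smul_smul, mul_inv_cancel₀ (norm_ne_zero_iff.mpr hx), one_smul]

theorem abs_sum_sign_mul_le {κ : Type} [Fintype κ] (β γ : κ → ℝ) :
    |∑ j, (SignType.sign (β j) : ℝ) * γ j| ≤ ∑ j, |γ j| := by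
  refine (Finset.abs_sum_le_sum_abs _ _).trans (Finset.sum_le_sum fun j _ => ?_)
  rw [abs_mul]
  refine mul_le_of_le_one_left (abs_nonneg _) ?_
  cases SignType.sign (β j) <;> simp

/-- For a fixed coefficient vector, the worst-case residual over the induced `(1,2)`-norm ball is
the nominal residual plus the `ℓ₁` penalty, and it is attained. -/
theorem isGreatest_residual_image {ι κ : Type} [Fintype ι] [Fintype κ] {lam : ℝ} (hlam : 0 ≤ lam)
    (A : Matrix ι κ ℝ) (b : ι → ℝ) (β : κ → ℝ) (hι : β ≠ 0 → Nonempty ι) :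
    IsGreatest ((fun Δ : Matrix ι κ ℝ => lpNorm 2 (b - (A + Δ).mulVec β)) ''
        {Δ : Matrix ι κ ℝ | ∀ γ : κ → ℝ, lpNorm 2 (Δ.mulVec γ) ≤ lam * lpNorm 1 γ})
      (lpNorm 2 (b - A.mulVec β) + lam * lpNorm 1 β) := by
  have hsub (Δ : Matrix ι κ ℝ) : b - (A + Δ).mulVec β = (b - A.mulVec β) - Δ.mulVec β := by
    rw [Matrix.add_mulVec, sub_sub]
  constructor
  · rcases eq_or_ne β 0 with rfl | hβ
    · refine ⟨0, fun γ => ?_, by simp [lpNorm_one_eq_sum]⟩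
      rw [lpNorm_one_eq_sum, lpNorm_two_eq_norm]
      simpa using mul_nonneg hlam (Finset.sum_nonneg fun j _ => abs_nonneg (γ j))
    · have := hι hβ
      obtain ⟨u, hu, hr⟩ := exists_norm_eq_one_norm_smul_eq (WithLp.toLp 2 (b - A.mulVec β))
      set Δ : Matrix ι κ ℝ := fun i j => -(lam * u i * (SignType.sign (β j) : ℝ)) with hΔ
      have hmul (γ : κ → ℝ) : WithLp.toLp 2 (Δ.mulVec γ) =
          (-(lam * ∑ j, (SignType.sign (β j) : ℝ) * γ j)) • u := by
        ext i
        simp only [hΔ, Matrix.mulVec, dotProduct, PiLp.smul_apply, smul_eq_mul, Finset.mul_sum,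
          Finset.sum_mul, ← Finset.sum_neg_distrib]
        exact Finset.sum_congr rfl fun j _ => by ring
      refine ⟨Δ, fun γ => ?_, ?_⟩
      · rw [lpNorm_two_eq_norm, hmul, norm_smul, hu, mul_one, norm_neg, Real.norm_eq_abs, abs_mul,
          abs_of_nonneg hlam, lpNorm_one_eq_sum]
        exact mul_le_mul_of_nonneg_left (abs_sum_sign_mul_le β γ) hlam
      · have hl : 0 ≤ lam * ∑ j, |β j| :=
          mul_nonneg hlam (Finset.sum_nonneg fun j _ => abs_nonneg _)
        simp only [hsub, lpNorm_two_eq_norm, lpNorm_one_eq_sum]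
        rw [WithLp.toLp_sub, hmul]
        simp only [sign_mul_self]
        nth_rewrite 1 [← hr]
        rw [← sub_smul, sub_neg_eq_add, norm_smul, hu, mul_one, Real.norm_eq_abs,
          abs_of_nonneg (add_nonneg (norm_nonneg _) hl)]
  · rintro _ ⟨Δ, hΔ, rfl⟩
    have h := hΔ β
    simp only [hsub]
    rw [lpNorm_two_eq_norm] at h ⊢
    rw [lpNorm_two_eq_norm, WithLp.toLp_sub]
    exact (norm_sub_le _ _).trans (by gcongr)

/-- Adaptive Lasso: with the induced-norm uncertainty set
`U_{(1,2)} = {Δ : ‖Δβ‖_2 ≤ λ‖β‖_1 for all β}`,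
`inf_{β ∈ Ω_adapt} sup_{Δ ∈ U_{(1,2)}} ‖y − (X̃ + Δ)β‖_2
  = inf_{β ∈ Ω_adapt} (‖y − X̃β‖_2 + λ‖β‖_1)`. -/
theorem statement9 {T m τ : ℕ} (hτ : 1 ≤ τ)
    (lam : ℝ) (hlam : 0 ≤ lam) (X : ℤ → Fin m → ℝ) (y : ℤ → ℝ) :
    sInf ((fun β : Fin T × Fin m → ℝ =>
        sSup ((fun Δ : Matrix (Fin T) (Fin T × Fin m) ℝ =>
            lpNorm 2 (targetVec T y - (blockDiag T m X + Δ).mulVec β)) ''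
          {Δ : Matrix (Fin T) (Fin T × Fin m) ℝ |
            ∀ β' : Fin T × Fin m → ℝ, lpNorm 2 (Δ.mulVec β') ≤ lam * lpNorm 1 β'})) ''
      OmegaAdapt T m τ X y)
    = sInf ((fun β : Fin T × Fin m → ℝ =>
        lpNorm 2 (targetVec T y - (blockDiag T m X).mulVec β) + lam * lpNorm 1 β) ''
      OmegaAdapt T m τ X y) := by
  refine congrArg sInf (Set.image_congr fun β _ => ?_)
  refine (isGreatest_residual_image hlam _ _ β fun hβ => ?_).csSup_eq
  obtain ⟨⟨t, _⟩, _⟩ := Function.ne_iff.mp hβ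
  exact ⟨t⟩
end
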